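/- For every positive CNF formula φ over a finite variable set V, every partial assignment σ (a function from a subset D ⊆ V to Bool) and every player p ∈ {True, False} to move, player True has a winning strategy in the free-choice PosCNF game from (σ, p) if and only if player True has a winning strategy in the own-value PosCNF game from (σ, p). -/

import Mathlib

/-- A positive CNF formula over variable set `V`: a finite set of clauses,
each clause a finite set of variables (no negated literals). -/
abbrev PosCNF (V : Type*) := Finset (Finset V)

/-- Player True has a winning strategy in the PosCNF game on `φ` from position
`(σ, p)`, where `σ : V → Option Bool` is a partial assignment (`none` means
unassigned, so its domain is `D = {v | σ v ≠ none} ⊆ V`) and `p : Bool` is the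
player to move (`true` = player True, `false` = player False).

The parameter `allowed pl b` records which value `b` player `pl` may assign:
in the free-choice game any value is allowed, while in the own-value game
player True must use `true` and player False must use `false`.

When all variables are assigned the game is over and player True wins iff
every clause of `φ` contains a variable assigned true.  Otherwise, if player
True is to move, True has a winning strategy iff some legal move leads to a
position from which True has a winning strategy; if player False is to move,
True has a winning strategy iff every legal move leads to a position from
which True has a winning strategy. -/
inductive TrueWins {V : Type*} [DecidableEq V] (φ : PosCNF V)
    (allowed : Bool → Bool → Prop) : (V → Option Bool) → Bool → Prop where
  | terminal (σ : V → Option Bool) (p : Bool)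
      (hterm : ∀ v : V, σ v ≠ none)
      (heval : ∀ c ∈ φ, ∃ v ∈ c, σ v = some true) :
      TrueWins φ allowed σ p
  | moverWins (σ : V → Option Bool) (v : V) (b : Bool)
      (hv : σ v = none) (hb : allowed true b)
      (h : TrueWins φ allowed (Function.update σ v (some b)) false) :
      TrueWins φ allowed σ true
  | opponentForced (σ : V → Option Bool)
      (hnonterm : ∃ v : V, σ v = none)
      (h : ∀ (v : V) (b : Bool), σ v = none → allowed false b →
        TrueWins φ allowed (Function.update σ v (some b)) true) :
      TrueWins φ allowed σ false

/-- In the free-choice game the mover may assign any value. -/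
def freeChoice : Bool → Bool → Prop := fun _ _ => True

/-- In the own-value game player True must assign `true` and player False
must assign `false`. -/
def ownValue : Bool → Bool → Prop := fun pl b => b = pl

/-- Changing assigned values from false to true preserves a win of player True,
whatever the rule on allowed values. -/
theorem TrueWins.mono {V : Type*} [DecidableEq V] {φ : PosCNF V}
    {allowed : Bool → Bool → Prop} {σ τ : V → Option Bool} {p : Bool}
    (h : TrueWins φ allowed σ p) (hdom : ∀ v, σ v = none ↔ τ v = none)
    (hle : ∀ v, σ v = some true → τ v = some true) : TrueWins φ allowed τ p := by
  induction h generalizing τ with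
  | terminal σ p hterm heval =>
    refine .terminal τ p (fun v hv => hterm v ((hdom v).2 hv)) fun c hc => ?_
    obtain ⟨v, hvc, hv⟩ := heval c hc
    exact ⟨v, hvc, hle v hv⟩
  | moverWins σ v b hv hb _ ih =>
    refine .moverWins τ v b ((hdom v).1 hv) hb (ih (fun w => ?_) fun w => ?_) <;>
      by_cases hw : w = v <;> simp_all
  | opponentForced σ hnonterm _ ih =>
    refine .opponentForced τ (hnonterm.imp fun v => (hdom v).1) fun v b hv hb =>
      ih v b ((hdom v).2 hv) hb (fun w => ?_) fun w => ?_ <;>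
      by_cases hw : w = v <;> simp_all

/-- Player True prefers a variable to be assigned true rather than false. -/
theorem TrueWins.update_true {V : Type*} [DecidableEq V] {φ : PosCNF V}
    {allowed : Bool → Bool → Prop} {σ : V → Option Bool} {p : Bool} {v : V} {b : Bool}
    (h : TrueWins φ allowed (Function.update σ v (some b)) p) :
    TrueWins φ allowed (Function.update σ v (some true)) p := by
  refine h.mono (fun w => ?_) fun w => ?_ <;> by_cases hw : w = v <;> simp_all

/-- For every positive CNF formula `φ` over a finite variable set `V`, every
partial assignment `σ` and every player `p` to move, player True has a winning
strategy in the free-choice PosCNF game from `(σ, p)` iff player True has a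
winning strategy in the own-value PosCNF game from `(σ, p)`. -/
theorem trueWins_freeChoice_iff_ownValue {V : Type*} [Fintype V] [DecidableEq V]
    (φ : PosCNF V) (σ : V → Option Bool) (p : Bool) :
    TrueWins φ freeChoice σ p ↔ TrueWins φ ownValue σ p := by
  constructor
  · intro h
    induction h with
    | terminal σ p hterm heval => exact .terminal σ p hterm heval
    | moverWins σ v b hv _ _ ih => exact .moverWins σ v true hv rfl ih.update_true
    | opponentForced σ hnonterm _ ih =>
      exact .opponentForced σ hnonterm fun v b hv _ => ih v b hv trivial
  · intro h
    induction h with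
    | terminal σ p hterm heval => exact .terminal σ p hterm heval
    | moverWins σ v b hv _ _ ih => exact .moverWins σ v b hv trivial ih
    | opponentForced σ hnonterm _ ih =>
      refine .opponentForced σ hnonterm fun v b hv _ => ?_
      cases b with
      | false => exact ih v false hv rfl
      | true => exact (ih v false hv rfl).update_true
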